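/- arXiv:1701.06540 — 2 statements merged into one kernel-verified Lean document; each statement's English description precedes it below -/
import Mathlib

section
/- If B ⊂ ℝⁿ is a maximal S-free convex set such that B ∩ conv(S) has nonempty interior, then every facet of the polyhedron B contains a point of S in its relative interior. -/
open scoped BigOperators Pointwise

noncomputable section

/-- Euclidean space `ℝⁿ`. -/
abbrev E (n : ℕ) := EuclideanSpace ℝ (Fin n)

/-- Dot product on `ℝⁿ`. -/
def dot {n : ℕ} (x y : E n) : ℝ := ∑ i, x i * y i

/-- A point with integral coordinates. -/
def IsIntPt {n : ℕ} (x : E n) : Prop := ∀ i, ∃ m : ℤ, x i = (m : ℝ)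

/-- A vector with rational coordinates. -/
def IsRatVec {n : ℕ} (x : E n) : Prop := ∀ i, ∃ q : ℚ, x i = (q : ℝ)

/-- `S` is the set of integral points of a rational polyhedron `{x | Ax ≤ b}`. -/
def IsIntPtsOfRatPolyhedron {n : ℕ} (S : Set (E n)) : Prop :=
  ∃ (m : ℕ) (A : Fin m → E n) (b : Fin m → ℝ),
    (∀ i, IsRatVec (A i)) ∧ (∀ i, ∃ q : ℚ, b i = (q : ℝ)) ∧
    S = {x | IsIntPt x ∧ ∀ i, dot (A i) x ≤ b i}

/-- `dim S = n`: `S` contains `n+1` affinely independent points. -/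
def FullDimSet {n : ℕ} (S : Set (E n)) : Prop :=
  ∃ p : Fin (n + 1) → E n, (∀ i, p i ∈ S) ∧ AffineIndependent ℝ p

/-- `B` is `S`-free: the interior of `B` contains no point of `S`. -/
def SFree {n : ℕ} (S B : Set (E n)) : Prop := ∀ x ∈ interior B, x ∉ S

/-- `B` is a maximal `S`-free convex set. -/
def MaxSFree {n : ℕ} (S B : Set (E n)) : Prop :=
  Convex ℝ B ∧ SFree S B ∧
    ∀ C : Set (E n), Convex ℝ C → SFree S C → B ⊆ C → B = C

/-- `B` is lattice-free: no integral point in its interior. -/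
def LatticeFree {n : ℕ} (B : Set (E n)) : Prop := ∀ x ∈ interior B, ¬ IsIntPt x

/-- `B` is a maximal lattice-free convex set. -/
def MaxLatticeFree {n : ℕ} (B : Set (E n)) : Prop :=
  Convex ℝ B ∧ LatticeFree B ∧
    ∀ C : Set (E n), Convex ℝ C → LatticeFree C → B ⊆ C → B = C

/-- A polyhedron: finite intersection of closed half-spaces. -/
def IsPolyhedron {n : ℕ} (B : Set (E n)) : Prop :=
  ∃ (m : ℕ) (a : Fin m → E n) (c : Fin m → ℝ), B = {x | ∀ i, dot (a i) x ≤ c i}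

/-- A polytope: convex hull of finitely many points. -/
def IsPolytope {n : ℕ} (P : Set (E n)) : Prop :=
  ∃ V : Finset (E n), P = convexHull ℝ (V : Set (E n))

/-- Dimension of a set: dimension of its affine hull. -/
def sdim {n : ℕ} (A : Set (E n)) : ℕ := Module.finrank ℝ (affineSpan ℝ A).direction

/-- `F` is a face of the convex set `B`. -/
def IsFaceOf {n : ℕ} (F B : Set (E n)) : Prop :=
  F ⊆ B ∧ Convex ℝ F ∧ ∀ x ∈ B, ∀ y ∈ B, ∀ t : ℝ, 0 < t → t < 1 →
    t • x + (1 - t) • y ∈ F → x ∈ F ∧ y ∈ F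

/-- `F` is a facet of `B`: a nonempty face of dimension `dim B - 1`. -/
def IsFacetOf {n : ℕ} (F B : Set (E n)) : Prop :=
  IsFaceOf F B ∧ F.Nonempty ∧ sdim F + 1 = sdim B

/-- Recession cone of `K`. -/
def recCone {n : ℕ} (K : Set (E n)) : Set (E n) :=
  {d | ∀ x ∈ K, ∀ t : ℝ, 0 ≤ t → x + t • d ∈ K}

/-- Lineality space of `K`. -/
def linSpace {n : ℕ} (K : Set (E n)) : Set (E n) :=
  {d | d ∈ recCone K ∧ -d ∈ recCone K}

/-- The set of all finite nonnegative combinations of elements of `G`. -/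
def conicHullOf {n : ℕ} (G : Set (E n)) : Set (E n) :=
  {x | ∃ (m : ℕ) (c : Fin m → ℝ) (v : Fin m → E n),
    (∀ i, 0 ≤ c i) ∧ (∀ i, v i ∈ G) ∧ x = ∑ i, c i • v i}

/-- A cone is rational if it is generated by vectors with rational coordinates. -/
def IsRationalCone {n : ℕ} (C : Set (E n)) : Prop :=
  ∃ G : Set (E n), (∀ v ∈ G, IsRatVec v) ∧ C = conicHullOf G

/-- A linear subspace is rational if it is spanned by rational vectors. -/
def IsRationalSubspace {n : ℕ} (L : Submodule ℝ (E n)) : Prop :=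
  ∃ G : Set (E n), (∀ v ∈ G, IsRatVec v) ∧ L = Submodule.span ℝ G

/-- The hyperplane `{x | a·x = β}` is a supporting hyperplane of `C`. -/
def IsSupportingHyperplane {n : ℕ} (a : E n) (β : ℝ) (C : Set (E n)) : Prop :=
  ((∀ x ∈ C, dot a x ≤ β) ∨ (∀ x ∈ C, β ≤ dot a x)) ∧
    ∃ x ∈ closure C, dot a x = β

/-- `ψ` is a valid function with respect to `f` and `S`. -/
def ValidFn {n : ℕ} (S : Set (E n)) (f : E n) (ψ : E n → ℝ) : Prop :=
  ∀ s : (E n) →₀ ℝ, (∀ r, 0 ≤ s r) →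
    (f + s.sum fun r c => c • r) ∈ S →
    1 ≤ s.sum fun r c => ψ r * c

/-- Sublinear: positively homogeneous and subadditive. -/
def Sublinear {n : ℕ} (ψ : E n → ℝ) : Prop :=
  (∀ t : ℝ, 0 ≤ t → ∀ r, ψ (t • r) = t * ψ r) ∧
  (∀ r r', ψ (r + r') ≤ ψ r + ψ r')

/-- Polar of `K`. -/
def polar {n : ℕ} (K : Set (E n)) : Set (E n) := {y | ∀ r ∈ K, dot y r ≤ 1}

/-- `K̂ = {y ∈ K* | ∃ x ∈ K, x·y = 1}`. -/
def Khat {n : ℕ} (K : Set (E n)) : Set (E n) :=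
  {y | y ∈ polar K ∧ ∃ x ∈ K, dot x y = 1}

/-- `ρ_K(r) = sup { y·r | y ∈ K̂ }`. -/
def rho {n : ℕ} (K : Set (E n)) (r : E n) : ℝ :=
  sSup ((fun y => dot y r) '' Khat K)

namespace SF

open Filter Topology Set

variable {n : ℕ}

lemma isInt_add {x y : E n} (hx : IsIntPt x) (hy : IsIntPt y) : IsIntPt (x + y) := by
  intro i
  obtain ⟨a, ha⟩ := hx i
  obtain ⟨b, hb⟩ := hy i
  exact ⟨a + b, by simp [ha, hb]⟩

lemma isInt_neg {x : E n} (hx : IsIntPt x) : IsIntPt (-x) := by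
  intro i
  obtain ⟨a, ha⟩ := hx i
  exact ⟨-a, by simp [ha]⟩

lemma isInt_sub {x y : E n} (hx : IsIntPt x) (hy : IsIntPt y) : IsIntPt (x - y) := by
  rw [sub_eq_add_neg]; exact isInt_add hx (isInt_neg hy)

lemma isInt_zero : IsIntPt (0 : E n) := fun i => ⟨0, by simp⟩

/-- The integral points in a ball are finite. -/
lemma finite_int (R : ℝ) : {x : E n | IsIntPt x ∧ ‖x‖ ≤ R}.Finite := by
  have hf : (Set.pi univ (fun _ : Fin n => (Icc (-⌈R⌉) ⌈R⌉ : Set ℤ))).Finite :=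
    Set.Finite.pi' (fun _ => Set.finite_Icc _ _) |>.subset (by intro x hx i; exact hx i trivial)
  refine (hf.image (fun m : Fin n → ℤ => (WithLp.toLp 2 (fun i => (m i : ℝ)) : E n))).subset ?_
  rintro x ⟨hx, hR⟩
  choose m hm using hx
  refine ⟨m, ?_, ?_⟩
  · intro i _
    have h1 : |x i| ≤ R := by
      have := PiLp.norm_apply_le x i
      rw [Real.norm_eq_abs] at this
      linarith
    rw [hm i] at h1
    have h2 := abs_le.1 h1
    have h3 := Int.le_ceil R
    constructor
    · have : (-(⌈R⌉ : ℤ) : ℝ) ≤ (m i : ℝ) := by linarith [h2.1]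
      exact_mod_cast this
    · have : (m i : ℝ) ≤ (⌈R⌉ : ℝ) := by linarith [h2.2]
      exact_mod_cast this
  · ext i
    simp [hm i]

/-- Dirichlet approximation of a ray by integral points. -/
lemma dirichlet (c : E n) (ε : ℝ) (hε : 0 < ε) (N : ℝ) (hN : 0 < N) :
    ∃ (z : E n) (l : ℝ), IsIntPt z ∧ N ≤ l ∧ ‖z - l • c‖ < ε := by
  let fl : ℕ → E n := fun m => WithLp.toLp 2 (fun i => (⌊(m : ℝ) * (N * c i)⌋ : ℝ))
  let x : ℕ → E n := fun m => (m : ℝ) • (N • c) - fl m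
  have hfl : ∀ m, IsIntPt (fl m) := fun m i => ⟨_, rfl⟩
  have hb : ∀ m, x m ∈ Metric.closedBall (0 : E n) (Real.sqrt n) := by
    intro m
    rw [mem_closedBall_zero_iff, EuclideanSpace.norm_eq]
    apply Real.sqrt_le_sqrt
    calc ∑ i, ‖x m i‖ ^ 2 ≤ ∑ i : Fin n, (1 : ℝ) := by
          apply Finset.sum_le_sum
          intro i _
          have : x m i = Int.fract ((m : ℝ) * (N * c i)) := by
            rw [← Int.self_sub_floor]
            simp [x, fl, -Int.self_sub_floor]
          rw [this, Real.norm_eq_abs, sq_abs]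
          have h0 := Int.fract_nonneg ((m : ℝ) * (N * c i))
          have h1 := Int.fract_lt_one ((m : ℝ) * (N * c i))
          nlinarith
      _ = n := by simp
  obtain ⟨a, _, φ, hφ, hlim⟩ := tendsto_subseq_of_bounded Metric.isBounded_closedBall hb
  obtain ⟨K, hK⟩ := Metric.cauchySeq_iff'.1 hlim.cauchySeq ε hε
  have h := hK (K + 1) (by omega)
  have hlt : φ K < φ (K + 1) := hφ (by omega)
  refine ⟨fl (φ (K+1)) - fl (φ K), ((φ (K+1) : ℝ) - φ K) * N, isInt_sub (hfl _) (hfl _), ?_, ?_⟩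
  · have : (φ K : ℝ) + 1 ≤ φ (K+1) := by exact_mod_cast hlt
    nlinarith
  · rw [dist_eq_norm] at h
    rw [← norm_neg]
    have e : -(fl (φ (K + 1)) - fl (φ K) - (((φ (K + 1) : ℝ) - φ K) * N) • c) =
        (x ∘ φ) (K + 1) - (x ∘ φ) K := by
      simp only [x, Function.comp]
      module
    rw [e]; exact h

lemma dirichlet_seq (c : E n) : ∃ (z : ℕ → E n) (l : ℕ → ℝ), (∀ k, IsIntPt (z k)) ∧
    Tendsto l atTop atTop ∧ Tendsto (fun k => z k - l k • c) atTop (𝓝 0) := by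
  have h : ∀ k : ℕ, ∃ (z : E n) (l : ℝ), IsIntPt z ∧ (k + 1 : ℝ) ≤ l ∧ ‖z - l • c‖ < 1 / (k + 1 : ℝ) :=
    fun k => dirichlet c _ (by positivity) _ (by positivity)
  choose z l h1 h2 h3 using h
  refine ⟨z, l, h1, ?_, ?_⟩
  · refine tendsto_atTop_mono (fun k => ?_) tendsto_natCast_atTop_atTop
    linarith [h2 k]
  · refine squeeze_zero_norm (fun k => (h3 k).le) tendsto_one_div_add_atTop_nhds_zero_nat

/-- Along the Dirichlet sequence, integral functionals behave like on the ray. -/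
lemma seq_zero (a : E n →L[ℝ] ℝ) (ha : ∀ z, IsIntPt z → ∃ m : ℤ, a z = m) (c : E n)
    (z : ℕ → E n) (l : ℕ → ℝ) (hz : ∀ k, IsIntPt (z k))
    (hw : Tendsto (fun k => z k - l k • c) atTop (𝓝 0)) (hc : a c = 0) :
    ∀ᶠ k in atTop, a (z k) = 0 := by
  have h : Tendsto (fun k => a (z k - l k • c)) atTop (𝓝 0) := by
    have := (a.continuous.tendsto 0).comp hw
    rwa [map_zero] at this
  have h2 := h.eventually (Metric.ball_mem_nhds (0 : ℝ) one_pos)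
  filter_upwards [h2] with k hk
  obtain ⟨m, hm⟩ := ha _ (hz k)
  simp [hc, hm] at hk
  rw [hm]
  have : |m| < 1 := by exact_mod_cast hk
  rw [Int.abs_lt_one_iff] at this
  simp [this]

lemma seq_neg (a : E n →L[ℝ] ℝ) (c : E n)
    (z : ℕ → E n) (l : ℕ → ℝ) (hl : Tendsto l atTop atTop)
    (hw : Tendsto (fun k => z k - l k • c) atTop (𝓝 0)) (hc : a c < 0) :
    Tendsto (fun k => a (z k)) atTop atBot := by
  have h : Tendsto (fun k => a (z k - l k • c)) atTop (𝓝 0) := by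
    have := (a.continuous.tendsto 0).comp hw
    rwa [map_zero] at this
  have h2 : Tendsto (fun k => l k * a c + a (z k - l k • c)) atTop atBot :=
    (hl.atTop_mul_const_of_neg hc).atBot_add h
  refine h2.congr (fun k => ?_)
  simp

/-- translations preserving `B` -/
def Rec (B : Set (E n)) : Set (E n) := {d | ∀ x ∈ B, x + d ∈ B}

/-- lineality space as a submodule -/
def Lin (B : Set (E n)) : Submodule ℝ (E n) where
  carrier := {v | ∀ r : ℝ, r • v ∈ Rec B}
  zero_mem' := by intro r x hx; simpa using hx
  add_mem' := by
    intro v w hv hw r x hx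
    have := hw r _ (hv r x hx)
    rwa [smul_add, ← add_assoc]
  smul_mem' := by
    intro c v hv r
    rw [smul_smul]; exact hv _

lemma Lin_rec {B : Set (E n)} {v : E n} (hv : v ∈ Lin B) : v ∈ Rec B := by
  simpa using hv 1

lemma rec_interior {B : Set (E n)} {d x : E n} (hd : d ∈ Rec B) (hx : x ∈ interior B) :
    x + d ∈ interior B := by
  have h : (fun y => y + d) '' interior B ⊆ interior B := by
    apply interior_maximal
    · rintro _ ⟨y, hy, rfl⟩
      exact hd y (interior_subset hy)
    · exact (Homeomorph.addRight d).isOpenMap _ isOpen_interior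
  exact h ⟨x, hx, rfl⟩

lemma lin_interior {B : Set (E n)} {d x : E n} (hd : d ∈ Lin B) :
    x + d ∈ B ↔ x ∈ B := by
  constructor
  · intro h
    have := Lin_rec ((Lin B).neg_mem hd) _ h
    simpa using this
  · exact fun h => Lin_rec hd _ h

/-- The setting -/
structure Setting (S B : Set (E n)) (m : ℕ) (a : Fin m → E n →L[ℝ] ℝ) (b : Fin m → ℝ) : Prop where
  int : ∀ i z, IsIntPt z → ∃ k : ℤ, a i z = k
  eq : S = {x | IsIntPt x ∧ ∀ i, a i x ≤ b i}
  max : MaxSFree S B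
  ne : (interior B).Nonempty

variable {S B : Set (E n)} {m : ℕ} {a : Fin m → E n →L[ℝ] ℝ} {b : Fin m → ℝ}

lemma Setting.closed (h : Setting S B m a b) : IsClosed B := by
  have := h.max.2.2 (closure B) h.max.1.closure (by
    intro x hx
    rw [h.max.1.interior_closure_eq_interior_of_nonempty_interior h.ne] at hx
    exact h.max.2.1 x hx) subset_closure
  rw [this]; exact isClosed_closure

lemma Setting.closure_int (h : Setting S B m a b) : closure (interior B) = B := by
  rw [h.max.1.closure_interior_eq_closure_of_nonempty_interior h.ne, h.closed.closure_eq]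

/-- translations approximated by integral recession vectors of the polyhedron modulo `Rec B` -/
def G (B : Set (E n)) (a : Fin m → E n →L[ℝ] ℝ) : Set (E n) :=
  {v | ∀ δ > 0, ∃ z, IsIntPt z ∧ (∀ i, a i z ≤ 0) ∧ ∃ l ∈ Rec B, ‖z - l - v‖ < δ}

lemma Setting.G_free (h : Setting S B m a b) {y v : E n} (hy : y ∈ S) (hv : v ∈ G B a) :
    y + v ∉ interior B := by
  intro hi
  obtain ⟨δ, hδ, hball⟩ := Metric.isOpen_iff.1 isOpen_interior _ hi
  obtain ⟨z, hz, haz, l, hl, hn⟩ := hv δ hδ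
  have h1 : y + (z - l) ∈ interior B := by
    apply hball
    rw [Metric.mem_ball, dist_eq_norm]
    have e : y + (z - l) - (y + v) = z - l - v := by abel
    rw [e]; exact hn
  have h2 := rec_interior hl h1
  have h3 : y + (z - l) + l = y + z := by abel
  rw [h3] at h2
  refine h.max.2.1 _ h2 ?_
  rw [h.eq] at hy ⊢
  refine ⟨isInt_add hy.1 hz, fun i => ?_⟩
  rw [map_add]
  linarith [hy.2 i, haz i]

lemma Setting.mem_Lin (h : Setting S B m a b) {v : E n} (hv : ∀ t : ℝ, t • v ∈ G B a) :
    v ∈ Lin B := by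
  let B' : Set (E n) := interior B + (Submodule.span ℝ {v} : Set (E n))
  have hopen : IsOpen B' := isOpen_interior.add_right
  have hconv : Convex ℝ B' := h.max.1.interior.add (Submodule.convex _)
  have hsub : ∀ r : ℝ, ∀ x ∈ B, x + r • v ∈ closure B' := by
    intro r x hx
    rw [← h.closure_int] at hx
    have hmaps : MapsTo (fun y => y + r • v) (interior B) B' := by
      intro y hy
      exact add_mem_add hy (Submodule.smul_mem _ _ (Submodule.mem_span_singleton_self v))
    exact map_mem_closure (f := fun y => y + r • v) (by fun_prop) hx hmaps
  have hne' : (interior B').Nonempty := by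
    rw [hopen.interior_eq]
    exact h.ne.add ⟨0, Submodule.zero_mem _⟩
  have heq : B = closure B' := by
    apply h.max.2.2 _ hconv.closure
    · intro y hy hyS
      rw [hconv.interior_closure_eq_interior_of_nonempty_interior hne', hopen.interior_eq] at hy
      obtain ⟨x, hx, u, hu, rfl⟩ := hy
      obtain ⟨t, rfl⟩ := Submodule.mem_span_singleton.1 hu
      apply h.G_free hyS (hv (-t))
      simpa using hx
    · intro x hx
      simpa using hsub 0 x hx
  intro r x hx
  rw [heq]
  exact hsub r x hx

/-- recession directions of `B` and the polyhedron are lineality directions of `B` -/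
lemma Setting.rec_sub_lin (h : Setting S B m a b) {c : E n} (hc : ∀ t : ℝ, 0 ≤ t → t • c ∈ Rec B)
    (hac : ∀ i, a i c ≤ 0) : c ∈ Lin B := by
  apply h.mem_Lin
  intro t δ hδ
  obtain ⟨z, l, hz, hl, hw⟩ := dirichlet_seq c
  have h1 : ∀ i, ∀ᶠ k in atTop, a i (z k) ≤ 0 := by
    intro i
    rcases (hac i).lt_or_eq with h0 | h0
    · exact (seq_neg (a i) c z l hl hw h0).eventually_le_atBot 0
    · exact (seq_zero (a i) (h.int i) c z l hz hw h0).mono fun k hk => hk.le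
  have h2 := eventually_all.2 h1
  have h3 := hw.eventually (Metric.ball_mem_nhds (0 : E n) hδ)
  obtain ⟨k, hk2, hk3, hk4⟩ := (h2.and (h3.and (hl.eventually_ge_atTop t))).exists
  refine ⟨z k, hz k, hk2, (l k - t) • c, hc _ (by linarith), ?_⟩
  rw [dist_zero_right] at hk3
  have e : z k - (l k - t) • c - t • c = z k - l k • c := by module
  rw [e]; exact hk3

/-- rationality: nearby integral points lie in the lineality space -/
lemma Setting.ev_lin (h : Setting S B m a b) {c : E n} (hc : c ∈ Lin B)
    (hac : ∀ i, a i c ≤ 0) (z : ℕ → E n) (l : ℕ → ℝ) (hz : ∀ k, IsIntPt (z k))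
    (hl : Tendsto l atTop atTop)
    (hw : Tendsto (fun k => z k - l k • c) atTop (𝓝 0)) : ∀ᶠ k in atTop, z k ∈ Lin B := by
  by_contra hcon
  let p : E n →L[ℝ] E n := (Lin B)ᗮ.starProjection
  have hp : ∀ x, x - p x ∈ Lin B := by
    intro x
    have := (Lin B)ᗮ.sub_starProjection_mem_orthogonal x
    rwa [Submodule.orthogonal_orthogonal] at this
  have hpm : ∀ x, p x ∈ (Lin B)ᗮ := fun x => Submodule.starProjection_apply_mem _ x
  have hpc : p c = 0 := Submodule.starProjection_orthogonal_apply_eq_zero hc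
  have hpz : Tendsto (fun k => p (z k)) atTop (𝓝 0) := by
    have : Tendsto (fun k => p (z k - l k • c)) atTop (𝓝 0) := by
      have := (p.continuous.tendsto 0).comp hw
      rwa [map_zero] at this
    simpa [hpc] using this
  -- the monoid of projected integral recession vectors
  let M : AddSubmonoid (E n) :=
    { carrier := {v | ∃ z, IsIntPt z ∧ (∀ i, a i z ≤ 0) ∧ p z = v}
      zero_mem' := ⟨0, isInt_zero, by simp, by simp⟩
      add_mem' := by
        rintro _ _ ⟨x, hx, hax, rfl⟩ ⟨y, hy, hay, rfl⟩
        refine ⟨x + y, isInt_add hx hy, fun i => ?_, by simp⟩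
        rw [map_add]; linarith [hax i, hay i] }
  have hMG : ∀ v ∈ M.topologicalClosure, v ∈ G B a := by
    intro v hv δ hδ
    obtain ⟨_, ⟨x, hx, hax, rfl⟩, hd⟩ := Metric.mem_closure_iff.1 hv δ hδ
    refine ⟨x, hx, hax, x - p x, Lin_rec (hp x), ?_⟩
    rw [dist_comm, dist_eq_norm] at hd
    have e : x - (x - p x) - v = p x - v := by abel
    rw [e]; exact hd
  have hle : ∀ᶠ k in atTop, ∀ i, a i (z k) ≤ 0 := by
    refine eventually_all.2 fun i => ?_
    rcases (hac i).lt_or_eq with h0 | h0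
    · exact (seq_neg (a i) c z l hl hw h0).eventually_le_atBot 0
    · exact (seq_zero (a i) (h.int i) c z l hz hw h0).mono fun k hk => hk.le
  have hze : ∀ᶠ k in atTop, ∀ i, a i c = 0 → a i (z k) = 0 := by
    refine eventually_all.2 fun i => ?_
    by_cases h0 : a i c = 0
    · exact (seq_zero (a i) (h.int i) c z l hz hw h0).mono fun k hk _ => hk
    · exact Eventually.of_forall fun k h1 => absurd h1 h0
  have hneg : ∀ᶠ k in atTop, -p (z k) ∈ M.topologicalClosure := by
    filter_upwards [hze] with k hk
    have hlim : Tendsto (fun j => p (z j - z k)) atTop (𝓝 (-p (z k))) := by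
      simpa using hpz.sub_const (p (z k))
    refine mem_closure_of_tendsto hlim ?_
    have : ∀ᶠ j in atTop, ∀ i, a i (z j) ≤ a i (z k) := by
      refine eventually_all.2 fun i => ?_
      rcases (hac i).lt_or_eq with h0 | h0
      · exact (seq_neg (a i) c z l hl hw h0).eventually_le_atBot _
      · filter_upwards [hze] with j hj
        rw [hj i h0, hk i h0]
    filter_upwards [this] with j hj
    refine ⟨z j - z k, isInt_sub (hz _) (hz _), fun i => ?_, rfl⟩
    rw [map_sub]; linarith [hj i]
  have hint : ∀ᶠ k in atTop, ∀ j : ℤ, j • p (z k) ∈ M.topologicalClosure := by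
    filter_upwards [hneg, hle] with k hk1 hk2 j
    have hk3 : p (z k) ∈ M.topologicalClosure := subset_closure ⟨z k, hz k, hk2, rfl⟩
    rcases j with j | j
    · simpa using nsmul_mem hk3 j
    · have := nsmul_mem hk1 (j + 1)
      simpa [negSucc_zsmul] using this
  -- pass to a subsequence with nonzero projections and converging directions
  have hfreq : ∃ᶠ k in atTop, z k ∉ Lin B ∧ ∀ j : ℤ, j • p (z k) ∈ M.topologicalClosure :=
    (not_eventually.1 hcon).and_eventually hint
  obtain ⟨φ, hφ, hφP⟩ := extraction_of_frequently_atTop hfreq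
  have hnz : ∀ k, p (z (φ k)) ≠ 0 := by
    intro k h0
    apply (hφP k).1
    simpa [h0] using hp (z (φ k))
  have hsph : ∀ k, ‖p (z (φ k))‖⁻¹ • p (z (φ k)) ∈ Metric.sphere (0 : E n) 1 := by
    intro k
    rw [mem_sphere_zero_iff_norm, norm_smul, norm_inv, norm_norm]
    exact inv_mul_cancel₀ (norm_ne_zero_iff.2 (hnz k))
  obtain ⟨ω, hω, ψ, hψ, hlim⟩ := (isCompact_sphere (0 : E n) 1).tendsto_subseq hsph
  have hωp : ω ∈ (Lin B)ᗮ := by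
    refine (Submodule.closed_of_finiteDimensional (Lin B)ᗮ).mem_of_tendsto hlim
      (Eventually.of_forall fun k => ?_)
    exact Submodule.smul_mem _ _ (hpm _)
  have hωL : ω ∈ Lin B := by
    apply h.mem_Lin
    intro t
    apply hMG
    have hφψ : Tendsto (fun k => φ (ψ k)) atTop atTop := hφ.tendsto_atTop.comp hψ.tendsto_atTop
    have hsmall : Tendsto (fun k => p (z (φ (ψ k)))) atTop (𝓝 0) := hpz.comp hφψ
    have hl1 : Tendsto (fun k => Int.fract (t / ‖p (z (φ (ψ k)))‖) • p (z (φ (ψ k)))) atTop (𝓝 0) := by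
      refine squeeze_zero_norm (fun k => ?_) (by simpa using hsmall.norm)
      rw [norm_smul, Real.norm_eq_abs, abs_of_nonneg (Int.fract_nonneg _)]
      exact mul_le_of_le_one_left (norm_nonneg _) (Int.fract_lt_one _).le
    have hl2 := (hlim.const_smul t).sub hl1
    rw [sub_zero] at hl2
    refine (M.isClosed_topologicalClosure).mem_of_tendsto hl2 (Eventually.of_forall fun k => ?_)
    have := (hφP (ψ k)).2 ⌊t / ‖p (z (φ (ψ k)))‖⌋
    have e : t • ((fun k => ‖p (z (φ k))‖⁻¹ • p (z (φ k))) ∘ ψ) k -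
        Int.fract (t / ‖p (z (φ (ψ k)))‖) • p (z (φ (ψ k))) =
        ⌊t / ‖p (z (φ (ψ k)))‖⌋ • p (z (φ (ψ k))) := by
      simp only [Function.comp, Int.fract]
      rw [smul_smul, ← sub_smul, ← Int.cast_smul_eq_zsmul ℝ]
      congr 1
      rw [div_eq_mul_inv]; ring
    rw [e]; exact this
  have h0 : ω = 0 := by
    have := Submodule.inner_right_of_mem_orthogonal hωL hωp
    exact inner_self_eq_zero.1 this
  rw [h0] at hω
  simp at hω

/-- Finitely many points of `S` represent, modulo the lineality space, all points of `S` near `B`. -/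
lemma Setting.finite_rep (h : Setting S B m a b) : ∃ T : Set (E n), T.Finite ∧ T ⊆ S ∧
    ∀ s ∈ S, s ∈ Metric.thickening 1 B → ∃ t ∈ T, s - t ∈ Lin B := by
  have hSint : ∀ x ∈ S, IsIntPt x := by
    intro x hx; rw [h.eq] at hx; exact hx.1
  have hSa : ∀ x ∈ S, ∀ i, a i x ≤ b i := by
    intro x hx; rw [h.eq] at hx; exact hx.2
  let T : Set (E n) := {t | t ∈ S ∧ t ∈ Metric.thickening 1 B ∧
    ∀ t' ∈ S, t' - t ∈ Lin B → ‖t‖ ≤ ‖t'‖}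
  have hbd : ∃ R : ℝ, ∀ t ∈ T, ‖t‖ ≤ R := by
    by_contra hcon
    push Not at hcon
    have hcon' : ∀ k : ℕ, ∃ t ∈ T, (k : ℝ) + 1 < ‖t‖ := fun k => hcon _
    choose t htT htn using hcon'
    have htpos : ∀ k, 0 < ‖t k‖ := fun k => lt_trans (by positivity) (htn k)
    have hsph : ∀ k, ‖t k‖⁻¹ • t k ∈ Metric.sphere (0 : E n) 1 := by
      intro k
      rw [mem_sphere_zero_iff_norm, norm_smul, norm_inv, norm_norm]
      exact inv_mul_cancel₀ (htpos k).ne'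
    obtain ⟨c, hc, φ, hφ, hlim⟩ := (isCompact_sphere (0 : E n) 1).tendsto_subseq hsph
    have hlim' : Tendsto (fun k => ‖t (φ k)‖⁻¹ • t (φ k)) atTop (𝓝 c) := hlim
    have hc1 : ‖c‖ = 1 := by simpa using hc
    have hnorm0 : Tendsto (fun k => ‖t k‖) atTop atTop :=
      tendsto_atTop_mono (fun k => by linarith [htn k]) tendsto_natCast_atTop_atTop
    have hnorm : Tendsto (fun k => ‖t (φ k)‖) atTop atTop := hnorm0.comp hφ.tendsto_atTop
    have hinv : Tendsto (fun k => ‖t (φ k)‖⁻¹) atTop (𝓝 0) := tendsto_inv_atTop_zero.comp hnorm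
    -- `c` is a recession direction of the polyhedron
    have halim : ∀ i, Tendsto (fun k => ‖t (φ k)‖⁻¹ * a i (t (φ k))) atTop (𝓝 (a i c)) := by
      intro i
      have := ((a i).continuous.tendsto c).comp hlim'
      refine this.congr fun k => ?_
      simp
    have hac : ∀ i, a i c ≤ 0 := by
      intro i
      have h2 : Tendsto (fun k => ‖t (φ k)‖⁻¹ * b i) atTop (𝓝 0) := by
        simpa using hinv.mul_const (b i)
      refine le_of_tendsto_of_tendsto' (halim i) h2 fun k => ?_
      exact mul_le_mul_of_nonneg_left (hSa _ (htT _).1 i) (inv_nonneg.2 (norm_nonneg _))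
    -- and of `B`
    have hcrec : ∀ r : ℝ, 0 ≤ r → r • c ∈ Rec B := by
      intro r hr x hx
      have hnear : ∀ k, ∃ y ∈ B, dist (t (φ k)) y < 1 :=
        fun k => Metric.mem_thickening_iff.1 (htT (φ k)).2.1
      choose y hyB hyd using hnear
      have hl1 : Tendsto (fun k => ‖t (φ k)‖⁻¹ • (y k - t (φ k))) atTop (𝓝 0) := by
        refine squeeze_zero_norm (fun k => ?_) hinv
        rw [norm_smul, norm_inv, norm_norm]
        have : ‖y k - t (φ k)‖ ≤ 1 := by
          rw [← dist_eq_norm, dist_comm]; exact (hyd k).le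
        exact mul_le_of_le_one_right (inv_nonneg.2 (norm_nonneg _)) this
      have hl2 : Tendsto (fun k => x + r • (‖t (φ k)‖⁻¹ • (y k - t (φ k)) + ‖t (φ k)‖⁻¹ • t (φ k)
          - ‖t (φ k)‖⁻¹ • x)) atTop (𝓝 (x + r • (0 + c - (0 : ℝ) • x))) :=
        (((hl1.add hlim').sub (hinv.smul_const x)).const_smul r).const_add x
      rw [zero_smul, zero_add, sub_zero] at hl2
      refine h.closed.mem_of_tendsto hl2 ?_
      filter_upwards [hnorm.eventually_ge_atTop r] with k hk
      have hpos := htpos (φ k)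
      have e : x + r • (‖t (φ k)‖⁻¹ • (y k - t (φ k)) + ‖t (φ k)‖⁻¹ • t (φ k)
          - ‖t (φ k)‖⁻¹ • x) = (1 - r * ‖t (φ k)‖⁻¹) • x + (r * ‖t (φ k)‖⁻¹) • y k := by module
      rw [e]
      have h1 : r * ‖t (φ k)‖⁻¹ ≤ 1 := by
        rw [← div_eq_mul_inv]; exact (div_le_one hpos).2 hk
      exact h.max.1 hx (hyB k) (by linarith) (mul_nonneg hr (inv_nonneg.2 hpos.le)) (by ring)
    have hcL := h.rec_sub_lin hcrec hac
    obtain ⟨z, l, hz, hl, hw⟩ := dirichlet_seq c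
    have hzL := h.ev_lin hcL hac z l hz hl hw
    have hze : ∀ᶠ k in atTop, ∀ i, a i c = 0 → a i (z k) = 0 := by
      refine eventually_all.2 fun i => ?_
      by_cases h0 : a i c = 0
      · exact (seq_zero (a i) (h.int i) c z l hz hw h0).mono fun k hk _ => hk
      · exact Eventually.of_forall fun k h1 => absurd h1 h0
    have hip : ∀ᶠ k in atTop, 0 < inner ℝ c (z k) := by
      filter_upwards [hw.eventually (Metric.ball_mem_nhds (0 : E n) one_pos),
        hl.eventually_ge_atTop 1] with k hk1 hk2
      rw [dist_zero_right] at hk1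
      have h1 : inner ℝ c (z k) = l k + inner ℝ c (z k - l k • c) := by
        rw [inner_sub_right, inner_smul_right, real_inner_self_eq_norm_sq, hc1]; ring
      have h2 := abs_real_inner_le_norm c (z k - l k • c)
      rw [hc1, one_mul] at h2
      have := (abs_le.1 h2).1
      linarith
    obtain ⟨k₀, hk1, hk2, hk3⟩ := (hzL.and (hze.and hip)).exists
    have hS' : ∀ᶠ k in atTop, ∀ i, a i (t (φ k) - z k₀) ≤ b i := by
      refine eventually_all.2 fun i => ?_
      rcases (hac i).lt_or_eq with h0 | h0
      · have hbot : Tendsto (fun k => ‖t (φ k)‖ * (‖t (φ k)‖⁻¹ * a i (t (φ k)))) atTop atBot :=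
          hnorm.atTop_mul_neg h0 (halim i)
        filter_upwards [hbot.eventually_le_atBot (b i + a i (z k₀))] with k hk
        rw [← mul_assoc, mul_inv_cancel₀ (htpos _).ne', one_mul] at hk
        rw [map_sub]; linarith
      · refine Eventually.of_forall fun k => ?_
        rw [map_sub, hk2 i h0, sub_zero]
        exact hSa _ (htT _).1 i
    have hip2 : Tendsto (fun k => ‖t (φ k)‖ * inner ℝ (‖t (φ k)‖⁻¹ • t (φ k)) (z k₀)) atTop atTop :=
      hnorm.atTop_mul_pos hk3 (hlim'.inner tendsto_const_nhds)
    obtain ⟨k, hkS, hkn⟩ := (hS'.and (hip2.eventually_ge_atTop (‖z k₀‖ ^ 2 + 1))).exists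
    rw [real_inner_smul_left, ← mul_assoc, mul_inv_cancel₀ (htpos _).ne', one_mul] at hkn
    have hmem : t (φ k) - z k₀ ∈ S := by
      rw [h.eq]; exact ⟨isInt_sub (hSint _ (htT _).1) (hz _), hkS⟩
    have hle := (htT (φ k)).2.2 _ hmem (by
      have : t (φ k) - z k₀ - t (φ k) = - z k₀ := by abel
      rw [this]; exact (Lin B).neg_mem hk1)
    have hsq := norm_sub_sq_real (t (φ k)) (z k₀)
    have hge : ‖t (φ k)‖ ^ 2 ≤ ‖t (φ k) - z k₀‖ ^ 2 := by gcongr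
    nlinarith [sq_nonneg ‖z k₀‖]
  obtain ⟨R, hR⟩ := hbd
  refine ⟨T, (finite_int R).subset fun t ht => ⟨hSint _ ht.1, hR t ht⟩, fun t ht => ht.1, ?_⟩
  intro s hs hsB
  have hfin : {t | t ∈ S ∧ s - t ∈ Lin B ∧ ‖t‖ ≤ ‖s‖}.Finite :=
    (finite_int ‖s‖).subset fun t ht => ⟨hSint _ ht.1, ht.2.2⟩
  obtain ⟨t, ⟨ht1, ht2, ht3⟩, hmin⟩ := Set.exists_min_image _ (fun t : E n => ‖t‖) hfin
    ⟨s, hs, by simp, le_refl _⟩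
  refine ⟨t, ⟨ht1, ?_, ?_⟩, ht2⟩
  · obtain ⟨y, hy, hd⟩ := Metric.mem_thickening_iff.1 hsB
    refine Metric.mem_thickening_iff.2 ⟨y + -(s - t), Lin_rec ((Lin B).neg_mem ht2) y hy, ?_⟩
    rw [dist_eq_norm] at hd ⊢
    have e : t - (y + -(s - t)) = s - y := by abel
    rw [e]; exact hd
  · intro t' ht' hL
    by_cases hcase : ‖t'‖ ≤ ‖s‖
    · refine hmin t' ⟨ht', ?_, hcase⟩
      have e : s - t' = (s - t) - (t' - t) := by abel
      rw [e]; exact (Lin B).sub_mem ht2 hL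
    · linarith

lemma lin_of_bdd {g : E n →L[ℝ] ℝ} {c : ℝ} (hg : ∀ x ∈ B, g x ≤ c) (hne : B.Nonempty)
    {v : E n} (hv : v ∈ Lin B) : g v = 0 := by
  obtain ⟨x, hx⟩ := hne
  by_contra h0
  have := hg _ (hv ((c - g x + 1) / g v) x hx)
  rw [map_add, map_smul, smul_eq_mul, div_mul_cancel₀ _ h0] at this
  linarith

/-- `B` is the intersection of its neighbourhood with suitable half-spaces. -/
lemma Setting.eq_inter (h : Setting S B m a b) {T : Set (E n)}
    (hrep : ∀ s ∈ S, s ∈ Metric.thickening 1 B → ∃ t ∈ T, s - t ∈ Lin B)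
    (g : E n → E n →L[ℝ] ℝ) (c : E n → ℝ) (hg0 : ∀ t ∈ T, g t ≠ 0)
    (hgB : ∀ t ∈ T, ∀ x ∈ B, g t x ≤ c t) (hgt : ∀ t ∈ T, c t ≤ g t t) :
    B = Metric.thickening 1 B ∩ {x | ∀ t ∈ T, g t x ≤ c t} := by
  apply h.max.2.2
  · apply (h.max.1.thickening 1).inter
    intro x hx y hy p q hp hq hpq t ht
    have h1 := hx t ht
    have h2 := hy t ht
    rw [map_add, map_smul, map_smul, smul_eq_mul, smul_eq_mul]
    have : c t = p * c t + q * c t := by rw [← add_mul, hpq, one_mul]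
    rw [this]
    gcongr
  · intro x hx hxS
    obtain ⟨t, ht, hL⟩ := hrep x hxS (interior_subset hx).1
    have h1 : g t x = g t t := by
      have := lin_of_bdd (hgB t ht) (h.ne.mono interior_subset) hL
      rw [map_sub] at this; linarith
    obtain ⟨v, hv⟩ : ∃ v, g t v ≠ 0 := by
      by_contra hcon
      push Not at hcon
      exact hg0 t ht (by ext v; simpa using hcon v)
    have hlim : Tendsto (fun r : ℝ => x + r • (g t v • v)) (𝓝[>] 0) (𝓝 x) := by
      have : Continuous (fun r : ℝ => x + r • (g t v • v)) := by fun_prop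
      have h2 := this.tendsto 0
      simp only [zero_smul, add_zero] at h2
      exact h2.mono_left nhdsWithin_le_nhds
    have hev := hlim.eventually (isOpen_interior.mem_nhds hx)
    obtain ⟨r, hr, hr0⟩ := (hev.and self_mem_nhdsWithin).exists
    have h3 := (interior_subset hr).2 t ht
    have hr0' : 0 < r := hr0
    rw [map_add, map_smul, map_smul, smul_eq_mul, smul_eq_mul] at h3
    have h4 : 0 < r * (g t v * g t v) := mul_pos hr0' (mul_self_pos.2 hv)
    linarith [hgt t ht]
  · intro x hx
    exact ⟨Metric.self_subset_thickening one_pos B hx, fun t ht => hgB t ht x hx⟩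

lemma mem_relint {F : Set (E n)} {x : E n} :
    x ∈ intrinsicInterior ℝ F ↔ x ∈ affineSpan ℝ F ∧
      ∃ δ > 0, ∀ y ∈ affineSpan ℝ F, dist y x < δ → y ∈ F := by
  rw [mem_intrinsicInterior]
  constructor
  · rintro ⟨y, hy, rfl⟩
    refine ⟨y.2, ?_⟩
    obtain ⟨δ, hδ, hb⟩ := Metric.isOpen_iff.1 isOpen_interior _ hy
    exact ⟨δ, hδ, fun w hw hd => interior_subset (s := (Subtype.val ⁻¹' F : Set (affineSpan ℝ F)))
      (hb (show (⟨w, hw⟩ : affineSpan ℝ F) ∈ Metric.ball y δ from hd))⟩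
  · rintro ⟨hx, δ, hδ, hb⟩
    refine ⟨⟨x, hx⟩, ?_, rfl⟩
    rw [mem_interior_iff_mem_nhds, Metric.mem_nhds_iff]
    exact ⟨δ, hδ, fun w hw => hb w.1 w.2 hw⟩

/-- extending a segment slightly beyond a relative interior point -/
lemma extend_relint {F : Set (E n)} {f x : E n} (hf : f ∈ intrinsicInterior ℝ F)
    (hx : x ∈ affineSpan ℝ F) :
    ∃ y ∈ F, ∃ t : ℝ, 0 < t ∧ t < 1 ∧ t • x + (1 - t) • y = f := by
  obtain ⟨hfA, δ, hδ, hb⟩ := mem_relint.1 hf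
  have hcont : Tendsto (fun r : ℝ => AffineMap.lineMap f x (-r)) (𝓝[>] 0) (𝓝 f) := by
    have : Continuous (fun r : ℝ => (AffineMap.lineMap f x (-r) : E n)) := by
      simp only [AffineMap.lineMap_apply]; fun_prop
    have h2 := this.tendsto 0
    simp only [neg_zero, AffineMap.lineMap_apply_zero] at h2
    exact h2.mono_left nhdsWithin_le_nhds
  obtain ⟨r, hr, hr0⟩ := ((hcont.eventually (Metric.ball_mem_nhds f hδ)).and
    self_mem_nhdsWithin).exists
  have hr0' : 0 < r := hr0
  refine ⟨_, hb _ (AffineMap.lineMap_mem _ hfA hx) hr, r / (1 + r), by positivity, ?_, ?_⟩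
  · rw [div_lt_one (by positivity)]; linarith
  · have h1 : (1 : ℝ) - r / (1 + r) = (1 + r)⁻¹ := by field_simp; ring
    rw [h1, AffineMap.lineMap_apply]
    simp only [vsub_eq_sub, vadd_eq_add]
    have h2 : (r / (1 + r)) • x + (1 + r)⁻¹ • (-r • (x - f) + f)
        = ((1 + r)⁻¹ * (1 + r)) • f := by
      rw [div_eq_mul_inv]; module
    rw [h2, inv_mul_cancel₀ (by positivity), one_smul]

/-- relative interior points are not on supporting hyperplanes, unless the whole set is -/
lemma relint_lt {F : Set (E n)} {f : E n} (hf : f ∈ intrinsicInterior ℝ F)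
    {g : E n →L[ℝ] ℝ} {c : ℝ} (hg : ∀ x ∈ F, g x ≤ c) {x : E n} (hx : x ∈ F) (hxc : g x < c) :
    g f < c := by
  obtain ⟨y, hy, t, ht0, ht1, rfl⟩ := extend_relint hf (subset_affineSpan ℝ F hx)
  rw [map_add, map_smul, map_smul, smul_eq_mul, smul_eq_mul]
  have := hg y hy
  nlinarith

theorem Setting.main (h : Setting S B m a b) (F : Set (E n)) (hF : IsFacetOf F B) :
    ∃ z ∈ S, z ∈ intrinsicInterior ℝ F := by
  by_contra hcon
  push Not at hcon
  obtain ⟨⟨hFB, hFc, hFf⟩, hFne, hFdim⟩ := hF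
  obtain ⟨f, hf⟩ := Set.Nonempty.intrinsicInterior hFc hFne
  have hfF : f ∈ F := intrinsicInterior_subset hf
  have hspanB : affineSpan ℝ B = ⊤ := h.max.1.interior_nonempty_iff_affineSpan_eq_top.1 h.ne
  have hdimB : sdim B = n := by
    rw [sdim, hspanB, AffineSubspace.direction_top, finrank_top]; simp
  -- a facet is disjoint from the interior
  have hfint : f ∉ interior B := by
    intro hfi
    have : F = B := by
      refine hFB.antisymm fun x hx => ?_
      obtain ⟨y, hy, t, ht0, ht1, hxy⟩ := extend_relint (F := B)
        (interior_subset_intrinsicInterior hfi) (subset_affineSpan ℝ B hx)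
      exact (hFf x hx y hy t ht0 ht1 (by rw [hxy]; exact hfF)).1
    rw [this] at hFdim
    omega
  -- the affine span of the facet meets `B` in the facet
  have hface : ∀ x ∈ B, x ∈ affineSpan ℝ F → x ∈ F := by
    intro x hx hxA
    obtain ⟨y, hy, t, ht0, ht1, hxy⟩ := extend_relint hf hxA
    exact (hFf x hx y (hFB hy) t ht0 ht1 (by rw [hxy]; exact hfF)).1
  obtain ⟨T, hTfin, hTS, hrep⟩ := h.finite_rep
  -- local description of half-space intersections
  have hloc : ∀ (T' : Set (E n)) (g : E n → E n →L[ℝ] ℝ) (c : E n → ℝ), T'.Finite →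
      ∀ x ∈ B, (∀ t ∈ T', g t x < c t) →
      ∃ δ > 0, ∀ y, dist y x < δ → y ∈ Metric.thickening 1 B ∧ ∀ t ∈ T', g t y ≤ c t := by
    intro T' g c hT' x hx hlt
    have h1 : ∀ᶠ y in 𝓝 x, y ∈ Metric.thickening 1 B :=
      Metric.isOpen_thickening.mem_nhds (Metric.self_subset_thickening one_pos B hx)
    have h2 : ∀ᶠ y in 𝓝 x, ∀ t ∈ T', g t y ≤ c t := by
      rw [eventually_all_finite hT']
      intro t ht
      exact ((g t).continuous.tendsto x).eventually (Iic_mem_nhds (hlt t ht))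
    obtain ⟨δ, hδ, hb⟩ := Metric.eventually_nhds_iff.1 (h1.and h2)
    exact ⟨δ, hδ, fun y hy => hb hy⟩
  -- first family of half-spaces
  have hsep : ∀ t : E n, ∃ g : E n →L[ℝ] ℝ, t ∈ T → g ≠ 0 ∧ ∀ x ∈ B, g x ≤ g t := by
    intro t
    by_cases ht : t ∈ T
    · have hti : t ∉ interior B := fun hi => h.max.2.1 t hi (hTS ht)
      obtain ⟨g, hg⟩ := geometric_hahn_banach_open_point h.max.1.interior isOpen_interior hti
      refine ⟨g, fun _ => ⟨?_, ?_⟩⟩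
      · rintro rfl
        obtain ⟨y, hy⟩ := h.ne
        simpa using hg y hy
      · intro x hx
        rw [← h.closure_int] at hx
        exact closure_minimal (fun y hy => (hg y hy).le)
          (isClosed_le g.continuous continuous_const) hx
    · exact ⟨0, fun h' => absurd h' ht⟩
  choose g hg using hsep
  have hB1 := h.eq_inter hrep g (fun t => g t t) (fun t ht => (hg t ht).1)
    (fun t ht => (hg t ht).2) (fun t _ => le_refl _)
  -- second family of half-spaces, never touching the relative interior of the facet
  have hsep2 : ∀ t : E n, ∃ (g' : E n →L[ℝ] ℝ) (c' : ℝ), t ∈ T →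
      g' ≠ 0 ∧ (∀ x ∈ B, g' x ≤ c') ∧ c' ≤ g' t ∧ g' f < c' := by
    intro t
    by_cases ht : t ∈ T
    swap
    · exact ⟨0, 0, fun h' => absurd h' ht⟩
    by_cases htB : t ∈ B
    swap
    · obtain ⟨g', u, h1, h2⟩ := geometric_hahn_banach_closed_point h.max.1 h.closed htB
      refine ⟨g', u, fun _ => ⟨?_, fun x hx => (h1 x hx).le, h2.le, h1 f (hFB hfF)⟩⟩
      rintro rfl
      have := h1 f (hFB hfF)
      simp at this h2
      linarith
    by_contra hno
    -- every constraint tight at `t` contains the facet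
    have htight : ∀ s ∈ T, g s t = g s s → ∀ x ∈ F, g s x = g s s := by
      intro s hs hst x hx
      by_contra hxs
      apply hno
      exact ⟨g s, g s s, fun _ => ⟨(hg s hs).1, (hg s hs).2, hst.ge,
        relint_lt hf (fun x hx => (hg s hs).2 x (hFB hx)) hx
          (lt_of_le_of_ne ((hg s hs).2 x (hFB hx)) hxs)⟩⟩
    obtain ⟨δ, hδ, hball⟩ := hloc {s ∈ T | g s t ≠ g s s} g (fun s => g s s)
      (hTfin.subset fun s hs => hs.1) t htB
      (fun s hs => lt_of_le_of_ne ((hg s hs.1).2 t htB) hs.2)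
    have hex : ∃ s ∈ T, g s t = g s s := by
      by_contra hnone
      push Not at hnone
      apply h.max.2.1 t _ (hTS ht)
      rw [mem_interior_iff_mem_nhds, Metric.mem_nhds_iff]
      refine ⟨δ, hδ, fun y hy => ?_⟩
      rw [hB1]
      have := hball y hy
      exact ⟨this.1, fun s hs => this.2 s ⟨hs, hnone s hs⟩⟩
    obtain ⟨s, hs, hst⟩ := hex
    have htA : t ∈ affineSpan ℝ F := by
      have hdir : (affineSpan ℝ F).direction = LinearMap.ker (g s : E n →ₗ[ℝ] ℝ) := by
        apply Submodule.eq_of_le_of_finrank_eq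
        · rw [direction_affineSpan, vectorSpan_def, Submodule.span_le]
          rintro _ ⟨x, hx, y, hy, rfl⟩
          simp [htight s hs hst x hx, htight s hs hst y hy]
        · have h1 := Module.Dual.finrank_ker_add_one_of_ne_zero (K := ℝ)
            (f := (g s : E n →ₗ[ℝ] ℝ)) (by
              intro h0
              apply (hg s hs).1
              ext v
              simpa using LinearMap.congr_fun h0 v)
          have h2 : Module.finrank ℝ (E n) = n := by simp
          rw [sdim, hdimB] at hFdim
          omega
      have hmem : t - f ∈ (affineSpan ℝ F).direction := by
        rw [hdir]
        simp [hst, htight s hs hst f hfF]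
      have := AffineSubspace.vadd_mem_of_mem_direction hmem (subset_affineSpan ℝ F hfF)
      simpa using this
    apply hcon t (hTS ht)
    refine mem_relint.2 ⟨htA, δ, hδ, fun y hyA hy => ?_⟩
    apply hface y _ hyA
    rw [hB1]
    have hby := hball y hy
    refine ⟨hby.1, fun s hs => ?_⟩
    by_cases hst : g s t = g s s
    · have hle : affineSpan ℝ F ≤ AffineSubspace.comap (g s : E n →ₗ[ℝ] ℝ).toAffineMap
          (affineSpan ℝ {g s s}) := by
        rw [affineSpan_le]
        intro x hx
        simp [htight s hs hst x hx]
      have := hle hyA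
      simp at this
      exact this.le
    · exact hby.2 s ⟨hs, hst⟩
  choose g' c' hg' using hsep2
  have hB2 := h.eq_inter hrep g' c' (fun t ht => (hg' t ht).1)
    (fun t ht => (hg' t ht).2.1) (fun t ht => (hg' t ht).2.2.1)
  obtain ⟨δ, hδ, hball⟩ := hloc T g' c' hTfin f (hFB hfF) (fun t ht => (hg' t ht).2.2.2)
  apply hfint
  rw [mem_interior_iff_mem_nhds, Metric.mem_nhds_iff]
  refine ⟨δ, hδ, fun y hy => ?_⟩
  rw [hB2]
  exact hball y hy

lemma dot_eq (x y : E n) : dot x y = innerSL ℝ x y := by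
  simp [dot, PiLp.inner_apply, mul_comm]

/-- Clearing denominators of a rational vector. -/
lemma clear_denom {x : E n} (hx : IsRatVec x) : ∃ D : ℕ, 0 < D ∧ IsIntPt ((D : ℝ) • x) := by
  choose q hq using hx
  refine ⟨∏ i, (q i).den, Finset.prod_pos fun i _ => (q i).pos, fun i => ?_⟩
  obtain ⟨k, hk⟩ := Finset.dvd_prod_of_mem (fun i => (q i).den) (Finset.mem_univ i)
  refine ⟨k * (q i).num, ?_⟩
  simp only [PiLp.smul_apply, smul_eq_mul]
  rw [hk, hq i]
  have h1 : ((q i).den : ℝ) * (q i : ℝ) = (q i).num := by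
    exact_mod_cast Rat.den_mul_eq_num (q i)
  push_cast
  linear_combination (k : ℝ) * h1

lemma int_dot {x y : E n} (hx : IsIntPt x) (hy : IsIntPt y) : ∃ k : ℤ, dot x y = k := by
  choose p hp using hx
  choose q hq using hy
  exact ⟨∑ i, p i * q i, by simp [dot, hp, hq]⟩

end SF

/-- Every facet of a maximal S-free convex set B with int(B ∩ conv S) ≠ ∅
contains a point of S in its relative interior. -/
theorem stmt_7 {n : ℕ} (S : Set (E n)) (hS : IsIntPtsOfRatPolyhedron S)
    (hdim : FullDimSet S) (B : Set (E n)) (hB : MaxSFree S B)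
    (hne : (interior (B ∩ convexHull ℝ S)).Nonempty) :
    ∀ F : Set (E n), IsFacetOf F B → ∃ z ∈ S, z ∈ intrinsicInterior ℝ F := by
  obtain ⟨m, A, b, hA, -, hSeq⟩ := hS
  choose D hD hDA using fun i => SF.clear_denom (hA i)
  have hset : SF.Setting S B m (fun i => innerSL ℝ ((D i : ℝ) • A i)) (fun i => (D i : ℝ) * b i) := by
    refine ⟨fun i z hz => ?_, ?_, hB, ?_⟩
    · rw [← SF.dot_eq]
      exact SF.int_dot (hDA i) hz
    · rw [hSeq]
      ext x
      have : ∀ i, dot (A i) x ≤ b i ↔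
          innerSL ℝ ((D i : ℝ) • A i) x ≤ (D i : ℝ) * b i := by
        intro i
        have hpos : (0 : ℝ) < D i := by exact_mod_cast hD i
        rw [SF.dot_eq, map_smul, ContinuousLinearMap.smul_apply, smul_eq_mul,
          mul_le_mul_iff_right₀ hpos]
      simp only [Set.mem_setOf_eq, this]
    · exact hne.mono (interior_mono Set.inter_subset_left)
  exact fun F hF => hset.main F hF
end
end

section
/- If B ⊂ ℝⁿ is a maximal S-free convex set such that B ∩ conv(S) has nonempty interior, then lin(B) ∩ rec(conv(S)) = rec(B) ∩ rec(conv(S)), and this cone is rational, i.e., generated by vectors with rational coordinates. -/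
open scoped BigOperators Pointwise

noncomputable section

/-- the point of the torus represented by `x`. -/
def toTorus {m : ℕ} (x : Fin m → ℝ) : UnitAddTorus (Fin m) := fun j => ((x j : ℝ) : UnitAddCircle)

lemma continuous_toTorus {m : ℕ} : Continuous (toTorus (m := m)) := by
  unfold toTorus
  refine continuous_pi fun j => ?_
  exact (AddCircle.continuous_mk' (1:ℝ)).comp (continuous_apply j)

lemma mFourier_toTorus {m : ℕ} (k : Fin m → ℤ) (α c : Fin m → ℝ) (t : ℝ) :
    UnitAddTorus.mFourier k (toTorus (t • α + c)) =
      Complex.exp ((2 * Real.pi * Complex.I * ((∑ j, k j * α j : ℝ) : ℂ)) * t) *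
        Complex.exp (2 * Real.pi * Complex.I * ((∑ j, k j * c j : ℝ) : ℂ)) := by
  rw [← Complex.exp_add]
  simp only [UnitAddTorus.mFourier, toTorus, ContinuousMap.coe_mk, fourier_coe_apply]
  rw [← Complex.exp_sum]
  congr 1
  push_cast
  rw [Finset.mul_sum, Finset.mul_sum, Finset.sum_mul, ← Finset.sum_add_distrib]
  refine Finset.sum_congr rfl fun j _ => ?_
  simp
  ring

lemma avg_diff {m : ℕ} (α : Fin m → ℝ) (hα : LinearIndependent ℤ α) (c c' : Fin m → ℝ)
    (f : C(UnitAddTorus (Fin m), ℂ)) :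
    Filter.Tendsto (fun T : ℝ => (T : ℂ)⁻¹ * ∫ t in (0:ℝ)..T,
      (f (toTorus (t • α + c)) - f (toTorus (t • α + c')))) Filter.atTop (nhds 0) := by
  have hcont : ∀ (f : C(UnitAddTorus (Fin m), ℂ)) (c : Fin m → ℝ),
      Continuous (fun t : ℝ => f (toTorus (t • α + c))) := by
    intro f c
    exact f.continuous.comp (continuous_toTorus.comp (by fun_prop))
  have h_integ : ∀ (f : C(UnitAddTorus (Fin m), ℂ)) (T : ℝ), IntervalIntegrable
      (fun t : ℝ => (f (toTorus (t • α + c)) - f (toTorus (t • α + c')))) MeasureTheory.volume 0 T :=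
    fun f T => ((hcont f c).sub (hcont f c')).intervalIntegrable _ _
  have hspan : ∀ f ∈ Submodule.span ℂ (Set.range (UnitAddTorus.mFourier (d := Fin m))),
      Filter.Tendsto (fun T : ℝ => (T : ℂ)⁻¹ * ∫ t in (0:ℝ)..T,
      (f (toTorus (t • α + c)) - f (toTorus (t • α + c')))) Filter.atTop (nhds 0) := by
    intro f hf
    induction hf using Submodule.span_induction with
    | mem f hf =>
      obtain ⟨k, rfl⟩ := hf
      by_cases hk : k = 0
      · subst hk
        simp [UnitAddTorus.mFourier_zero]
      have ha : (∑ j, k j * α j : ℝ) ≠ 0 := by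
        intro h0
        apply hk
        funext j
        refine Fintype.linearIndependent_iff.1 hα k ?_ j
        simpa [zsmul_eq_mul] using h0
      set a : ℂ := 2 * Real.pi * Complex.I * ((∑ j, k j * α j : ℝ) : ℂ) with ha'
      have ha0 : a ≠ 0 := by
        rw [ha']
        refine mul_ne_zero ?_ (by exact_mod_cast ha)
        simp [Real.pi_ne_zero]
      simp only [mFourier_toTorus, ← mul_sub, ← ha']
      have : ∀ T : ℝ, ‖∫ t in (0:ℝ)..T, Complex.exp (a * t) *
          (Complex.exp (2 * Real.pi * Complex.I * ((∑ j, k j * c j : ℝ) : ℂ)) -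
          Complex.exp (2 * Real.pi * Complex.I * ((∑ j, k j * c' j : ℝ) : ℂ)))‖ ≤ 2 / ‖a‖ *
          ‖(Complex.exp (2 * Real.pi * Complex.I * ((∑ j, k j * c j : ℝ) : ℂ)) -
          Complex.exp (2 * Real.pi * Complex.I * ((∑ j, k j * c' j : ℝ) : ℂ)))‖ := by
        intro T
        rw [intervalIntegral.integral_mul_const, integral_exp_mul_complex ha0, norm_mul, norm_div]
        gcongr
        refine (norm_sub_le _ _).trans ?_
        have e1 : ∀ x : ℝ, ‖Complex.exp (a * x)‖ = 1 := by
          intro x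
          rw [Complex.norm_exp, ha']
          simp
        rw [e1, e1]; norm_num
      refine squeeze_zero_norm' (a := fun T : ℝ => T⁻¹ * (2 / ‖a‖ *
          ‖(Complex.exp (2 * Real.pi * Complex.I * ((∑ j, k j * c j : ℝ) : ℂ)) -
          Complex.exp (2 * Real.pi * Complex.I * ((∑ j, k j * c' j : ℝ) : ℂ)))‖)) ?_ ?_
      · filter_upwards [Filter.eventually_gt_atTop 0] with T hT
        rw [norm_mul, norm_inv, Complex.norm_real, Real.norm_of_nonneg hT.le]
        gcongr
        exact this T
      · simpa using tendsto_inv_atTop_zero.mul_const (2 / ‖a‖ *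
          ‖(Complex.exp (2 * Real.pi * Complex.I * ((∑ j, k j * c j : ℝ) : ℂ)) -
          Complex.exp (2 * Real.pi * Complex.I * ((∑ j, k j * c' j : ℝ) : ℂ)))‖)
    | zero => simp
    | add f g _ _ hf hg =>
      have := hf.add hg
      rw [add_zero] at this
      refine this.congr fun T => ?_
      rw [← mul_add, ← intervalIntegral.integral_add (h_integ f T) (h_integ g T)]
      congr 2
      ext t
      simp only [ContinuousMap.add_apply]; ring
    | smul r f _ hf =>
      have := hf.const_mul r
      rw [mul_zero] at this
      refine this.congr fun T => ?_
      rw [mul_left_comm, ← intervalIntegral.integral_const_mul]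
      congr 2
      ext t
      simp only [ContinuousMap.smul_apply, smul_eq_mul]; ring
  have hf : f ∈ closure (Submodule.span ℂ (Set.range (UnitAddTorus.mFourier (d := Fin m))) :
      Set (C(UnitAddTorus (Fin m), ℂ))) := by
    rw [← Submodule.topologicalClosure_coe, UnitAddTorus.span_mFourier_closure_eq_top]
    trivial
  rw [Metric.tendsto_atTop]
  intro ε hε
  obtain ⟨g, hg, hfg⟩ := Metric.mem_closure_iff.1 hf (ε / 4) (by positivity)
  obtain ⟨N, hN⟩ := Metric.tendsto_atTop.1 (hspan g hg) (ε / 4) (by positivity)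
  refine ⟨max N 1, fun T hT => ?_⟩
  have hT0 : 0 < T := lt_of_lt_of_le one_pos ((le_max_right _ _).trans hT)
  have h1 := hN T ((le_max_left _ _).trans hT)
  rw [dist_zero_right] at h1 ⊢
  have hb : ∀ x, ‖f x - g x‖ ≤ ε / 4 := fun x => by
    rw [dist_eq_norm] at hfg
    exact ((f - g).norm_coe_le_norm x).trans hfg.le
  have h2 : ‖∫ t in (0:ℝ)..T, (((f (toTorus (t • α + c)) - f (toTorus (t • α + c')))) -
     ((g (toTorus (t • α + c)) - g (toTorus (t • α + c')))))‖ ≤ (ε / 2) * |T - 0| := by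
    apply intervalIntegral.norm_integral_le_of_norm_le_const
    intro t _
    have e : (((f (toTorus (t • α + c)) - f (toTorus (t • α + c')))) -
     ((g (toTorus (t • α + c)) - g (toTorus (t • α + c'))))) =
      ((f (toTorus (t • α + c)) - g (toTorus (t • α + c)))) -
     ((f (toTorus (t • α + c')) - g (toTorus (t • α + c')))) := by ring
    rw [e]
    refine (norm_sub_le _ _).trans ?_
    linarith [hb (toTorus (t • α + c)), hb (toTorus (t • α + c'))]
  rw [intervalIntegral.integral_sub (h_integ f T) (h_integ g T), sub_zero, abs_of_pos hT0] at h2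
  have h3 : ‖(T : ℂ)⁻¹ * ((∫ t in (0:ℝ)..T, (f (toTorus (t • α + c)) - f (toTorus (t • α + c')))) -
     ∫ t in (0:ℝ)..T, (g (toTorus (t • α + c)) - g (toTorus (t • α + c'))))‖ ≤ ε / 2 := by
    rw [norm_mul, norm_inv, Complex.norm_real, Real.norm_of_nonneg hT0.le, inv_mul_le_iff₀ hT0]
    linarith
  rw [mul_sub] at h3
  have := norm_le_norm_add_norm_sub ((T : ℂ)⁻¹ * ∫ t in (0:ℝ)..T, (g (toTorus (t • α + c)) - g (toTorus (t • α + c')))) ((T : ℂ)⁻¹ * ∫ t in (0:ℝ)..T, (f (toTorus (t • α + c)) - f (toTorus (t • α + c'))))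
  rw [norm_sub_rev] at this
  linarith

/-- Kronecker's theorem, continuous version. -/
lemma kronecker {m : ℕ} (α : Fin m → ℝ) (hα : LinearIndependent ℤ α) (c : Fin m → ℝ)
    (ε : ℝ) (hε : 0 < ε) (T₀ : ℝ) :
    ∃ t : ℝ, T₀ ≤ t ∧ ∃ p : Fin m → ℤ, ∀ j, |t * α j + c j - p j| < ε := by
  by_contra! hcon
  let f : C(UnitAddTorus (Fin m), ℂ) := ⟨fun x => ((max 0 (ε - ‖x‖) : ℝ) : ℂ), by fun_prop⟩
  have hf0 : ∀ t : ℝ, T₀ ≤ t → f (toTorus (t • α + c)) = 0 := by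
    intro t ht
    have : ε ≤ ‖toTorus (t • α + c)‖ := by
      by_contra! hlt
      obtain ⟨j, hj⟩ := hcon t ht (fun j => round (t * α j + c j))
      have := (norm_le_pi_norm (toTorus (t • α + c)) j)
      have h2 : ‖toTorus (t • α + c) j‖ = |t * α j + c j - round (t * α j + c j)| := by
        simp only [toTorus]
        rw [UnitAddCircle.norm_eq]
        simp
      linarith
    simp only [f, ContinuousMap.coe_mk]
    rw [max_eq_left (by linarith)]
    simp
  -- compactness
  have hcov : ∃ s : Finset (Fin m → ℝ), ∀ x : UnitAddTorus (Fin m), ∃ d ∈ s,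
      ‖x + toTorus d‖ < ε / 2 := by
    obtain ⟨s, hs⟩ := isCompact_univ.elim_finite_subcover
      (fun d : Fin m → ℝ => {x : UnitAddTorus (Fin m) | ‖x + toTorus d‖ < ε / 2})
      (fun d => isOpen_lt (by fun_prop) continuous_const) (by
        intro x _
        have : ∀ j, ∃ y : ℝ, ((y : ℝ) : UnitAddCircle) = - x j := fun j =>
          QuotientAddGroup.mk_surjective (- x j)
        choose y hy using this
        refine Set.mem_iUnion.2 ⟨y, ?_⟩
        have : toTorus y = - x := by
          funext j; simp [toTorus, hy]
        simp [this, hε])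
    refine ⟨s, fun x => ?_⟩
    have := hs (Set.mem_univ x)
    simpa using this
  obtain ⟨s, hs⟩ := hcov
  have hcont : ∀ (c : Fin m → ℝ),
      Continuous (fun t : ℝ => f (toTorus (t • α + c))) := by
    intro c
    exact f.continuous.comp (continuous_toTorus.comp (by fun_prop))
  have hlim := tendsto_finsetSum s (fun d _ => avg_diff α hα (T₀ • α + d) (T₀ • α + c) f)
  simp only [Finset.sum_const_zero] at hlim
  have hlow : ∀ T : ℝ, 0 < T → ε / 2 ≤ ‖∑ d ∈ s, (T : ℂ)⁻¹ * ∫ t in (0:ℝ)..T,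
      (f (toTorus (t • α + (T₀ • α + d))) - f (toTorus (t • α + (T₀ • α + c))))‖ := by
    intro T hT
    have e1 : ∀ d, ∫ t in (0:ℝ)..T,
      (f (toTorus (t • α + (T₀ • α + d))) - f (toTorus (t • α + (T₀ • α + c)))) =
      ∫ t in (0:ℝ)..T, f (toTorus (t • α + (T₀ • α + d))) := by
      intro d
      apply intervalIntegral.integral_congr
      intro t ht
      rw [Set.uIcc_of_le hT.le] at ht
      have := hf0 (t + T₀) (by linarith [ht.1])
      rw [add_smul, add_assoc] at this
      simp [this]
    simp only [e1]
    rw [← Finset.mul_sum, ← intervalIntegral.integral_finsetSum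
      (fun d _ => (hcont _).intervalIntegrable _ _)]
    have e2 : ∀ t : ℝ, ∑ d ∈ s, f (toTorus (t • α + (T₀ • α + d))) =
      ((∑ d ∈ s, max 0 (ε - ‖toTorus (t • α + (T₀ • α + d))‖) : ℝ) : ℂ) := by
      intro t; simp [f]
    simp only [e2]
    rw [intervalIntegral.integral_ofReal, norm_mul, norm_inv, Complex.norm_real,
      Complex.norm_real, Real.norm_of_nonneg hT.le, le_inv_mul_iff₀ hT]
    refine le_trans ?_ (le_abs_self _)
    have : ∫ t in (0:ℝ)..T, (ε / 2) = T * (ε / 2) := by simp; ring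
    rw [← this]
    apply intervalIntegral.integral_mono_on hT.le (by simp)
    · apply Continuous.intervalIntegrable
      refine continuous_finsetSum _ fun d _ => ?_
      have : Continuous fun t : ℝ => toTorus (t • α + (T₀ • α + d)) :=
        continuous_toTorus.comp (by fun_prop)
      fun_prop
    · intro t _
      obtain ⟨d, hd, hd2⟩ := hs (toTorus (t • α + T₀ • α))
      have e3 : toTorus (t • α + (T₀ • α + d)) = toTorus (t • α + T₀ • α) + toTorus d := by
        funext j; simp [toTorus, add_assoc]
      refine le_trans ?_ (Finset.single_le_sum (fun d _ => le_max_left 0 _) hd)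
      rw [e3]
      exact le_trans (by linarith) (le_max_right _ _)
  obtain ⟨N, hN⟩ := Metric.tendsto_atTop.1 hlim (ε / 2) (by positivity)
  have h1 := hN (max N 1) (le_max_left _ _)
  have h2 := hlow (max N 1) (lt_of_lt_of_le one_pos (le_max_right _ _))
  rw [dist_zero_right] at h1
  linarith

/-- `dot a` as a linear map. -/
def dotL {n : ℕ} (a : E n) : E n →ₗ[ℝ] ℝ where
  toFun x := dot a x
  map_add' x y := by simp [dot, mul_add, Finset.sum_add_distrib]
  map_smul' r x := by
    simp only [dot, PiLp.smul_apply, smul_eq_mul, RingHom.id_apply, Finset.mul_sum]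
    exact Finset.sum_congr rfl fun i _ => by ring

lemma dotL_apply {n : ℕ} (a x : E n) : dotL a x = dot a x := rfl

/-- the linear map `β ↦ ∑ β j • q j`. -/
def combL {n m : ℕ} (q : Fin m → E n) : (Fin m → ℝ) →ₗ[ℝ] E n :=
  Fintype.linearCombination ℝ q

lemma combL_apply {n m : ℕ} (q : Fin m → E n) (β : Fin m → ℝ) :
    combL q β = ∑ j, β j • q j := Fintype.linearCombination_apply _ _ _

lemma exists_decomp {n : ℕ} (w : E n) : ∃ (m : ℕ) (α : Fin m → ℝ) (q : Fin m → E n),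
    LinearIndependent ℤ α ∧ (∀ j, IsIntPt (q j)) ∧ combL q α = w := by
  let M : Submodule ℤ ℝ := Submodule.span ℤ (Set.range w)
  haveI : Module.Finite ℤ M := Module.Finite.span_of_finite ℤ (Set.finite_range _)
  haveI : Module.Free ℤ M := inferInstance
  let bs := Module.finBasis ℤ M
  have hw : ∀ i, w i ∈ M := fun i => Submodule.subset_span ⟨i, rfl⟩
  refine ⟨Module.finrank ℤ M, fun j => (bs j : ℝ),
    fun j => WithLp.toLp 2 (fun i => ((bs.repr ⟨w i, hw i⟩ j : ℤ) : ℝ)), ?_, ?_, ?_⟩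
  · exact bs.linearIndependent.map' M.subtype (Submodule.ker_subtype _)
  · intro j i
    exact ⟨_, rfl⟩
  · ext i
    have := congrArg (Subtype.val) (bs.sum_repr ⟨w i, hw i⟩)
    rw [combL_apply]
    simp only [Submodule.coe_sum, Submodule.coe_smul, zsmul_eq_mul] at this
    simp only [WithLp.ofLp_sum, WithLp.ofLp_smul, Finset.sum_apply, Pi.smul_apply, smul_eq_mul]
    conv_rhs => rw [← this]
    exact Finset.sum_congr rfl fun j _ => mul_comm _ _

lemma isRatVec_of_int {n : ℕ} {x : E n} (h : IsIntPt x) : IsRatVec x := fun i => by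
  obtain ⟨k, hk⟩ := h i
  exact ⟨k, by simp [hk]⟩

lemma dot_rat {n : ℕ} {a x : E n} (ha : IsRatVec a) (hx : IsRatVec x) :
    ∃ r : ℚ, dot a x = r := by
  choose f hf using ha
  choose g hg using hx
  exact ⟨∑ i, f i * g i, by simp [dot, hf, hg]⟩

lemma dot_zero_of_indep {n m : ℕ} (α : Fin m → ℝ) (hα : LinearIndependent ℤ α)
    (q : Fin m → E n) (hq : ∀ j, IsIntPt (q j)) (a : E n) (ha : IsRatVec a)
    (h : dot a (combL q α) = 0) (j : Fin m) : dot a (q j) = 0 := by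
  have hα' : LinearIndependent ℚ α := (LinearIndependent.iff_fractionRing ℤ ℚ).1 hα
  choose r hr using fun j => dot_rat ha (isRatVec_of_int (hq j))
  rw [← dotL_apply, combL_apply, map_sum] at h
  simp only [map_smul, dotL_apply, hr, smul_eq_mul] at h
  have := Fintype.linearIndependent_iff.1 hα' r (by
    simpa [Rat.smul_def, mul_comm] using h) j
  rw [hr, this]; simp

lemma isIntPt_combL {n m : ℕ} (q : Fin m → E n) (hq : ∀ j, IsIntPt (q j)) (p : Fin m → ℤ) :
    IsIntPt (combL q (fun j => (p j : ℝ))) := by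
  intro i
  choose z hz using hq
  refine ⟨∑ j, p j * z j i, ?_⟩
  rw [combL_apply]
  simp [hz]

lemma IsIntPt.add {n : ℕ} {x y : E n} (hx : IsIntPt x) (hy : IsIntPt y) : IsIntPt (x + y) := by
  intro i
  obtain ⟨a, ha⟩ := hx i
  obtain ⟨b, hb⟩ := hy i
  exact ⟨a + b, by simp [ha, hb]⟩

lemma key {n k m : ℕ} (S : Set (E n)) (A : Fin k → E n) (b : Fin k → ℝ)
    (hA : ∀ i, IsRatVec (A i)) (hS : S = {x | IsIntPt x ∧ ∀ i, dot (A i) x ≤ b i})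
    (B : Set (E n)) (hB : MaxSFree S B) (hne : (interior B).Nonempty)
    (α : Fin m → ℝ) (hα : LinearIndependent ℤ α) (q : Fin m → E n) (hq : ∀ j, IsIntPt (q j))
    (hwB : combL q α ∈ recCone B) (hwA : ∀ i, dot (A i) (combL q α) ≤ 0)
    (β : Fin m → ℝ) : combL q β ∈ recCone B := by
  obtain ⟨hconv, hfree, hmax⟩ := hB
  obtain ⟨p0, hp0⟩ := hne
  have hBC : B = B + Set.range (combL q) := by
    apply hmax
    · refine hconv.add ?_
      rw [← LinearMap.coe_range]
      exact (LinearMap.range (combL q)).convex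
    · intro x hx hxS
      -- a point of `int B` of the form `x + φ c`
      obtain ⟨c, hc⟩ : ∃ c, x + combL q c ∈ interior B := by
        have hcont : Filter.Tendsto (fun δ : ℝ => x + δ • (x - p0)) (nhdsWithin 0 (Set.Ioi 0))
            (nhds x) := by
          have : Continuous (fun δ : ℝ => x + δ • (x - p0)) := by fun_prop
          have h := this.tendsto 0
          simp only [zero_smul, add_zero] at h
          exact h.mono_left nhdsWithin_le_nhds
        have hev := hcont.eventually (mem_interior_iff_mem_nhds.1 hx)
        obtain ⟨δ, hδ1, hδ2⟩ := (hev.and self_mem_nhdsWithin).exists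
        have hδ : (0:ℝ) < δ := hδ2
        obtain ⟨y, hy, _, ⟨c, rfl⟩, hyc⟩ := hδ1
        have hδ' : (1 + δ) ≠ 0 := by positivity
        have := hconv.combo_interior_self_mem_interior hp0 hy
          (a := δ / (1 + δ)) (b := 1 / (1 + δ)) (by positivity) (by positivity) (by field_simp; ring)
        refine ⟨-(1 / (1 + δ)) • c, ?_⟩
        convert this using 1
        have hy' : y = x + δ • (x - p0) - combL q c := by
          rw [← hyc]; simp
        rw [hy', map_smul]
        match_scalars <;> field_simp <;> ring
      obtain ⟨ε, hε, hball⟩ := Metric.isOpen_iff.1 isOpen_interior _ hc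
      have hev1 : ∀ᶠ u in nhds (0 : Fin m → ℝ), ‖combL q u‖ < ε := by
        have h1 : Continuous (fun u => ‖combL q u‖) :=
          (LinearMap.continuous_of_finiteDimensional (combL q)).norm
        have h2 := h1.tendsto 0
        simp only [map_zero, norm_zero] at h2
        exact h2.eventually_lt_const hε
      have hev2 : ∀ᶠ u in nhds (0 : Fin m → ℝ), ∀ i, dot (A i) (combL q u) < 1 := by
        rw [Filter.eventually_all]
        intro i
        have h1 : Continuous (fun u => dotL (A i) (combL q u)) :=
          (LinearMap.continuous_of_finiteDimensional (dotL (A i) ∘ₗ combL q))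
        have h2 := h1.tendsto 0
        simp only [map_zero] at h2
        exact h2.eventually_lt_const one_pos
      obtain ⟨η, hη, hball2⟩ := Metric.eventually_nhds_iff_ball.1 (hev1.and hev2)
      have hev3 : ∀ᶠ t : ℝ in Filter.atTop, ∀ i, dot (A i) (combL q α) < 0 →
          dot (A i) (combL q c) + 1 + t * dot (A i) (combL q α) ≤ 0 := by
        rw [Filter.eventually_all]
        intro i
        by_cases hi : dot (A i) (combL q α) < 0
        · have := Filter.tendsto_id.atTop_mul_const_of_neg (r := dot (A i) (combL q α)) hi
            (l := (Filter.atTop : Filter ℝ))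
          filter_upwards [this.eventually_le_atBot (-(dot (A i) (combL q c) + 1))] with t ht _
          simp only [id] at ht
          linarith
        · exact Filter.Eventually.of_forall fun t h => absurd h hi
      obtain ⟨T, hT⟩ := Filter.eventually_atTop.1 hev3
      obtain ⟨t, ht, p, hp⟩ := kronecker α hα c η hη (max T 0)
      set u : Fin m → ℝ := fun j => (p j : ℝ) - (t * α j + c j) with hu
      have hpu : (fun j => (p j : ℝ)) = u + t • α + c := by
        funext j; simp [hu]; ring
      have hu_mem : u ∈ Metric.ball (0 : Fin m → ℝ) η := by
        rw [mem_ball_zero_iff, pi_norm_lt_iff hη]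
        intro j
        rw [Real.norm_eq_abs, abs_sub_comm]
        exact hp j
      obtain ⟨hu1, hu2⟩ := hball2 u hu_mem
      have hz : combL q (fun j => (p j : ℝ)) = combL q u + t • combL q α + combL q c := by
        rw [hpu, map_add, map_add, map_smul]
      -- the contradiction point
      refine hfree (x + combL q (fun j => (p j : ℝ))) ?_ ?_
      · have hsub : (fun y => y + t • combL q α) '' Metric.ball (x + combL q c) ε ⊆ B := by
          rintro _ ⟨y, hy, rfl⟩
          exact hwB y (interior_subset (hball hy)) t ((le_max_right _ _).trans ht)
        have hop : IsOpen ((fun y => y + t • combL q α) '' Metric.ball (x + combL q c) ε) :=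
          (Homeomorph.addRight (t • combL q α)).isOpenMap _ Metric.isOpen_ball
        refine interior_maximal hsub hop ⟨x + combL q c + combL q u, ?_, ?_⟩
        · simpa [Metric.mem_ball, dist_eq_norm] using hu1
        · simp only [hz]; abel
      · rw [hS] at hxS ⊢
        refine ⟨hxS.1.add (isIntPt_combL q hq p), fun i => ?_⟩
        have hle : dot (A i) (combL q (fun j => (p j : ℝ))) ≤ 0 := by
          rcases (hwA i).lt_or_eq with hlt | heq
          · have h1 := hT t ((le_max_left _ _).trans ht) i hlt
            have h2 := hu2 i
            rw [hz]
            simp only [← dotL_apply] at h1 h2 ⊢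
            rw [map_add, map_add, map_smul, smul_eq_mul]
            linarith
          · have := dot_zero_of_indep α hα q hq (A i) (hA i) heq
            rw [combL_apply]
            simp only [← dotL_apply] at this ⊢
            simp [this]
        have := hxS.2 i
        simp only [← dotL_apply] at this hle ⊢
        rw [map_add]
        linarith
    · intro x hx
      exact ⟨x, hx, 0, ⟨0, map_zero _⟩, add_zero x⟩
  intro x hx t _
  rw [hBC]
  exact ⟨x, hx, _, ⟨t • β, rfl⟩, by simp⟩

lemma convexHull_subset_conicHullOf {n : ℕ} (G : Set (E n)) :
    convexHull ℝ G ⊆ conicHullOf G := by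
  intro x hx
  rw [mem_convexHull_iff_exists_fintype] at hx
  obtain ⟨ι, _, w, z, hw, _, hz, hx⟩ := hx
  refine ⟨Fintype.card ι, w ∘ (Fintype.equivFin ι).symm, z ∘ (Fintype.equivFin ι).symm,
    fun i => hw _, fun i => hz _, ?_⟩
  rw [← hx]
  exact (Equiv.sum_comp (Fintype.equivFin ι).symm (fun i => w i • z i)).symm

lemma conicHullOf_mono {n : ℕ} {G H : Set (E n)} (h : G ⊆ H) : conicHullOf G ⊆ conicHullOf H := by
  rintro x ⟨m, c, v, hc, hv, hx⟩
  exact ⟨m, c, v, hc, fun i => h (hv i), hx⟩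

/-- Rational approximation inside the cone. -/
lemma rat_approx {n k m : ℕ} (A : Fin k → E n) (hA : ∀ i, IsRatVec (A i))
    (α : Fin m → ℝ) (hα : LinearIndependent ℤ α) (q : Fin m → E n) (hq : ∀ j, IsIntPt (q j))
    (hwA : ∀ i, dot (A i) (combL q α) ≤ 0) :
    combL q α ∈ conicHullOf {v | IsRatVec v ∧ (∀ i, dot (A i) v ≤ 0) ∧
      v ∈ Set.range (combL q)} := by
  have hev2 : ∀ᶠ u in nhds α, ∀ i, dot (A i) (combL q α) < 0 → dot (A i) (combL q u) < 0 := by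
    rw [Filter.eventually_all]
    intro i
    by_cases hi : dot (A i) (combL q α) < 0
    · have h1 : Continuous (fun u => dotL (A i) (combL q u)) :=
        (LinearMap.continuous_of_finiteDimensional (dotL (A i) ∘ₗ combL q))
      filter_upwards [(h1.tendsto α).eventually_lt_const hi] with u hu _
      exact hu
    · exact Filter.Eventually.of_forall fun t h => absurd h hi
  obtain ⟨η, hη, hball⟩ := Metric.eventually_nhds_iff_ball.1 hev2
  choose lo hlo1 hlo2 using fun j => exists_rat_btwn (show α j - η < α j by linarith)
  choose hi hhi1 hhi2 using fun j => exists_rat_btwn (show α j < α j + η by linarith)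
  let R : Set (Fin m → ℝ) := Set.univ.pi fun j => {(lo j : ℝ), (hi j : ℝ)}
  have hmem : α ∈ convexHull ℝ R := by
    rw [convexHull_pi]
    intro j _
    beta_reduce
    rw [convexHull_pair, segment_eq_Icc ((hlo2 j).trans (hhi1 j)).le]
    exact ⟨(hlo2 j).le, (hhi1 j).le⟩
  have himg : combL q α ∈ convexHull ℝ (combL q '' R) := by
    rw [← LinearMap.image_convexHull]
    exact ⟨α, hmem, rfl⟩
  refine conicHullOf_mono ?_ (convexHull_subset_conicHullOf _ himg)
  rintro _ ⟨u, hu, rfl⟩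
  have hu' : ∀ j, u j = lo j ∨ u j = hi j := fun j => by simpa [R] using hu j (Set.mem_univ j)
  refine ⟨?_, ?_, ⟨u, rfl⟩⟩
  · intro i
    have : ∀ j, ∃ r : ℚ, u j = r := fun j => by
      rcases hu' j with h | h
      · exact ⟨_, h⟩
      · exact ⟨_, h⟩
    choose r hr using this
    choose z hz using hq
    refine ⟨∑ j, r j * z j i, ?_⟩
    rw [combL_apply]
    simp [hz, hr]
  · intro i
    rcases (hwA i).lt_or_eq with hlt | heq
    · refine (hball u ?_ i hlt).le
      rw [mem_ball_iff_norm, pi_norm_lt_iff hη]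
      intro j
      rw [Real.norm_eq_abs, abs_lt, Pi.sub_apply]
      have := hlo1 j
      have := hlo2 j
      have := hhi1 j
      have := hhi2 j
      rcases hu' j with h | h <;> rw [h] <;> constructor <;> linarith
    · have := dot_zero_of_indep α hα q hq (A i) (hA i) heq
      rw [combL_apply]
      simp only [← dotL_apply] at this ⊢
      simp [this]

lemma recCone_zero {n : ℕ} (K : Set (E n)) : (0 : E n) ∈ recCone K := by
  intro x hx t _
  simpa using hx

lemma recCone_add {n : ℕ} {K : Set (E n)} {c d : E n} (hc : c ∈ recCone K) (hd : d ∈ recCone K) :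
    c + d ∈ recCone K := by
  intro x hx t ht
  have := hd _ (hc x hx t ht) t ht
  rwa [add_assoc, ← smul_add] at this

lemma recCone_smul {n : ℕ} {K : Set (E n)} {d : E n} (hd : d ∈ recCone K) {r : ℝ} (hr : 0 ≤ r) :
    r • d ∈ recCone K := by
  intro x hx t ht
  have := hd x hx (t * r) (by positivity)
  rwa [mul_smul] at this

lemma recCone_conic {n : ℕ} {K G : Set (E n)} (hG : G ⊆ recCone K) :
    conicHullOf G ⊆ recCone K := by
  rintro x ⟨m, c, v, hc, hv, rfl⟩
  refine Finset.sum_induction _ (· ∈ recCone K) (fun _ _ => recCone_add) (recCone_zero K) ?_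
  intro i _
  exact recCone_smul (hG (hv i)) (hc i)

lemma rat_mem_recCone {n k : ℕ} (S : Set (E n)) (A : Fin k → E n) (b : Fin k → ℝ)
    (hS : S = {x | IsIntPt x ∧ ∀ i, dot (A i) x ≤ b i}) (v : E n) (hv : IsRatVec v)
    (hvA : ∀ i, dot (A i) v ≤ 0) : v ∈ recCone (convexHull ℝ S) := by
  choose r hr using hv
  -- common denominator
  let N : ℕ := ∏ i, (r i).den
  have hN : 0 < N := Finset.prod_pos fun i _ => (r i).den_pos
  have h_integ : IsIntPt ((N : ℝ) • v) := by
    intro i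
    obtain ⟨d, hd⟩ : (r i).den ∣ N := Finset.dvd_prod_of_mem _ (Finset.mem_univ i)
    refine ⟨(r i).num * d, ?_⟩
    have h1 : ((r i).den : ℝ) * (r i : ℝ) = ((r i).num : ℝ) := by
      exact_mod_cast Rat.den_mul_eq_num (r i)
    simp only [PiLp.smul_apply, smul_eq_mul, hr, hd]
    push_cast
    rw [← h1]; ring
  have hNs : ∀ s ∈ S, ∀ l : ℕ, s + (l : ℝ) • ((N : ℝ) • v) ∈ S := by
    intro s hs l
    rw [hS] at hs ⊢
    refine ⟨hs.1.add ?_, fun i => ?_⟩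
    · intro i
      obtain ⟨a, ha⟩ := h_integ i
      refine ⟨l * a, ?_⟩
      rw [PiLp.smul_apply, ha]; simp
    · have h1 := hs.2 i
      have h2 := hvA i
      simp only [← dotL_apply] at h1 h2 ⊢
      rw [map_add, map_smul, map_smul, smul_eq_mul, smul_eq_mul]
      have : (l : ℝ) * ((N : ℝ) * dotL (A i) v) ≤ 0 :=
        mul_nonpos_of_nonneg_of_nonpos (by positivity)
          (mul_nonpos_of_nonneg_of_nonpos (by positivity) h2)
      linarith
  intro x hx t ht
  have hsub : S ⊆ (fun y => y + t • v) ⁻¹' convexHull ℝ S := by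
    intro s hs
    have hN' : (0 : ℝ) < N := by exact_mod_cast hN
    obtain ⟨l, hl⟩ := exists_nat_gt (t / N)
    have hl0 : (0:ℝ) < l := lt_of_le_of_lt (by positivity) hl
    have htl : t < l * N := by rwa [div_lt_iff₀ hN'] at hl
    have hseg := (convex_convexHull ℝ S) (subset_convexHull ℝ S hs)
      (subset_convexHull ℝ S (hNs s hs l)) (a := 1 - t / (l * N)) (b := t / (l * N))
      (by rw [sub_nonneg, div_le_one (by positivity)]; exact htl.le) (by positivity) (by ring)
    show s + t • v ∈ convexHull ℝ S
    convert hseg using 1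
    match_scalars <;> field_simp <;> ring
  have hconv : Convex ℝ ((fun y => y + t • v) ⁻¹' convexHull ℝ S) :=
    (convex_convexHull ℝ S).translate_preimage_left _
  exact convexHull_min hsub hconv hx

lemma dot_le_of_recCone {n k : ℕ} (S : Set (E n)) (A : Fin k → E n) (b : Fin k → ℝ)
    (hS : S = {x | IsIntPt x ∧ ∀ i, dot (A i) x ≤ b i}) (hne : S.Nonempty) (v : E n)
    (hv : v ∈ recCone (convexHull ℝ S)) (i : Fin k) : dot (A i) v ≤ 0 := by
  obtain ⟨s, hs⟩ := hne
  have hsub : convexHull ℝ S ⊆ {x | dotL (A i) x ≤ b i} := by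
    apply convexHull_min
    · intro x hx
      rw [hS] at hx
      exact hx.2 i
    · exact convex_halfSpace_le (dotL (A i)).isLinear _
  by_contra! hpos
  obtain ⟨l, hl⟩ := exists_nat_gt ((b i - dot (A i) s) / dot (A i) v)
  have h : dotL (A i) (s + (l : ℝ) • v) ≤ b i :=
    hsub (hv s (subset_convexHull ℝ S hs) l (by positivity))
  rw [map_add, map_smul, smul_eq_mul, dotL_apply, dotL_apply] at h
  rw [div_lt_iff₀ hpos] at hl
  linarith

/-- For a maximal S-free convex set B with int(B ∩ conv S) ≠ ∅,
lin(B) ∩ rec(conv S) = rec(B) ∩ rec(conv S) and this cone is rational. -/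
theorem stmt_8 {n : ℕ} (S : Set (E n)) (hS : IsIntPtsOfRatPolyhedron S)
    (hdim : FullDimSet S) (B : Set (E n)) (hB : MaxSFree S B)
    (hne : (interior (B ∩ convexHull ℝ S)).Nonempty) :
    linSpace B ∩ recCone (convexHull ℝ S) = recCone B ∩ recCone (convexHull ℝ S) ∧
    IsRationalCone (linSpace B ∩ recCone (convexHull ℝ S)) := by
  obtain ⟨k, A, b, hA, -, hSeq⟩ := hS
  obtain ⟨P, hP, -⟩ := hdim
  have hSne : S.Nonempty := ⟨P 0, hP 0⟩
  have hBne : (interior B).Nonempty := hne.mono (interior_mono Set.inter_subset_left)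
  have main : ∀ w ∈ recCone B ∩ recCone (convexHull ℝ S), w ∈ linSpace B ∧
      w ∈ conicHullOf {v | IsRatVec v ∧ v ∈ linSpace B ∩ recCone (convexHull ℝ S)} := by
    rintro w ⟨hwB, hwS⟩
    have hwA := dot_le_of_recCone S A b hSeq hSne w hwS
    obtain ⟨m, α, q, hα, hq, rfl⟩ := exists_decomp w
    have hk := key S A b hA hSeq B hB hBne α hα q hq hwB hwA
    have hlin : ∀ β, combL q β ∈ linSpace B := fun β =>
      ⟨hk β, by rw [← map_neg]; exact hk (-β)⟩
    refine ⟨hlin α, conicHullOf_mono ?_ (rat_approx A hA α hα q hq hwA)⟩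
    rintro v ⟨hv1, hv2, ⟨β, rfl⟩⟩
    exact ⟨hv1, hlin β, rat_mem_recCone S A b hSeq _ hv1 hv2⟩
  refine ⟨?_, {v | IsRatVec v ∧ v ∈ linSpace B ∩ recCone (convexHull ℝ S)},
    fun v hv => hv.1, ?_⟩
  · apply Set.Subset.antisymm
    · rintro w ⟨h1, h2⟩
      exact ⟨h1.1, h2⟩
    · rintro w hw
      exact ⟨(main w hw).1, hw.2⟩
  · apply Set.Subset.antisymm
    · rintro w ⟨h1, h2⟩
      exact (main w ⟨h1.1, h2⟩).2
    · intro w hw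
      have h1 : w ∈ recCone B := recCone_conic (fun v hv => hv.2.1.1) hw
      have h2 : w ∈ recCone (convexHull ℝ S) := recCone_conic (fun v hv => hv.2.2) hw
      exact ⟨(main w ⟨h1, h2⟩).1, h2⟩
end
end
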